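/- Differentiation under the integral sign for the transported integral (first identity in the proof of Lemma 3.2): Let Ω ⊆ ℝ^d be a bounded open set, let Φ : ℝ^d → ℝ^d, y : ℝ^d → ℝ, λ : ℝ^d → ℝ and ψ : ℝ^d → ℝ^d be C^∞ maps, and assume DΦ(x) is invertible for every x in the closure of Ω. Then the function s ↦ ∫_Ω y(x) · λ((Φ + s·ψ)(x)) · det(D(Φ + s·ψ)(x)) dx is differentiable at s = 0, and its derivative at 0 equals ∫_Ω [ y(x) · ⟨∇λ(Φ(x)), ψ(x)⟩ · det(DΦ(x)) + y(x) · λ(Φ(x)) · det(DΦ(x)) · trace((DΦ(x))⁻¹ · Dψ(x)) ] dx. -/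

import Mathlib

open Matrix MeasureTheory

/-- The Jacobian matrix of a map `Φ : ℝ^d → ℝ^d` at `x`: entry `(i, j)` is the partial
derivative of the `i`-th component of `Φ` in the `j`-th coordinate direction. -/
noncomputable def jacobianMatrix {d : ℕ} (Φ : (Fin d → ℝ) → (Fin d → ℝ))
    (x : Fin d → ℝ) : Matrix (Fin d) (Fin d) ℝ :=
  Matrix.of fun i j => fderiv ℝ Φ x (Pi.single j 1) i

/-- The gradient of a scalar function `y : ℝ^d → ℝ` at `x`. -/
noncomputable def grad {d : ℕ} (y : (Fin d → ℝ) → ℝ) (x : Fin d → ℝ) : Fin d → ℝ :=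
  fun i => fderiv ℝ y x (Pi.single i 1)

/-- Differentiation under the integral sign over a bounded set for a jointly `C¹` integrand. -/
theorem hasDerivAt_setIntegral_of_contDiff {E : Type*} [NormedAddCommGroup E] [NormedSpace ℝ E]
    [ProperSpace E] [MeasurableSpace E] [BorelSpace E] {μ : Measure E}
    [IsFiniteMeasureOnCompacts μ] {s : Set E} (hs : MeasurableSet s)
    (hbdd : Bornology.IsBounded s) {F : ℝ → E → ℝ} (hF : ContDiff ℝ 1 (Function.uncurry F))
    {F' : E → ℝ} (t : ℝ) (hF' : ∀ x ∈ s, HasDerivAt (fun r => F r x) (F' x) t) :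
    HasDerivAt (fun r => ∫ x in s, F r x ∂μ) (∫ x in s, F' x ∂μ) t := by
  have hK : IsCompact (closure s) := hbdd.isCompact_closure
  let G : ℝ → E → ℝ := fun r x => fderiv ℝ (Function.uncurry F) (r, x) (1, 0)
  have hG : Continuous (Function.uncurry G) :=
    (hF.continuous_fderiv one_ne_zero).clm_apply continuous_const
  have hFG : ∀ r x, HasDerivAt (fun r => F r x) (G r x) r := fun r x =>
    ((hF.differentiable one_ne_zero) (r, x)).hasFDerivAt.comp_hasDerivAt (f := fun r => (r, x)) r
      ((hasDerivAt_id r).prodMk (hasDerivAt_const r x))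
  have hslice : ∀ {H : ℝ → E → ℝ}, Continuous (Function.uncurry H) → ∀ r,
      IntegrableOn (H r) s μ := fun hH r =>
    ((hH.comp (Continuous.prodMk_right r)).continuousOn.integrableOn_compact hK).mono_set
      subset_closure
  obtain ⟨C, hC⟩ := ((isCompact_closedBall t 1).prod hK).exists_bound_of_continuousOn
    hG.continuousOn
  have hfin : IsFiniteMeasure (μ.restrict s) :=
    isFiniteMeasure_restrict.2 hbdd.measure_lt_top.ne
  have key := (hasDerivAt_integral_of_dominated_loc_of_deriv_le (μ := μ.restrict s)
    (bound := fun _ => C) (F' := G) (Metric.closedBall_mem_nhds t one_pos)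
    (Filter.Eventually.of_forall fun r => (hslice hF.continuous r).aestronglyMeasurable)
    (hslice hF.continuous t) (hslice hG t).aestronglyMeasurable
    ((ae_restrict_mem hs).mono fun x hx r hr => hC (r, x) ⟨hr, subset_closure hx⟩)
    (integrable_const C) (Filter.Eventually.of_forall fun x r _ => hFG r x)).2
  rwa [setIntegral_congr_fun hs fun x hx => (hFG t x).unique (hF' x hx)] at key

/-- Jacobi's formula for the determinant along an affine line through an invertible matrix. -/
theorem hasDerivAt_det_add_smul {n : Type*} [Fintype n] [DecidableEq n] {A : Matrix n n ℝ}
    (hA : IsUnit A) (B : Matrix n n ℝ) :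
    HasDerivAt (fun r : ℝ => (A + r • B).det) (A.det * (A⁻¹ * B).trace) 0 := by
  have hdet : IsUnit A.det := (Matrix.isUnit_iff_isUnit_det A).1 hA
  have hfactor : ∀ r : ℝ, (A + r • B).det = A.det * (1 + r • (A⁻¹ * B)).det := fun r => by
    rw [← Matrix.det_mul, Matrix.mul_add, Matrix.mul_one, Matrix.mul_smul,
      Matrix.mul_nonsing_inv_cancel_left A B hdet]
  simp only [hfactor]
  refine HasDerivAt.const_mul _ ?_
  rw [funext fun r : ℝ => Matrix.det_one_add_smul r (A⁻¹ * B)]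
  have h := (((hasDerivAt_id (0 : ℝ)).const_mul (A⁻¹ * B).trace).const_add 1).fun_add
    (((Polynomial.hasDerivAt (det (1 + (Polynomial.X : Polynomial ℝ) •
      (A⁻¹ * B).map Polynomial.C)).divX.divX 0)).fun_mul ((hasDerivAt_id (0 : ℝ)).fun_pow 2))
  refine h.congr_deriv ?_
  simp

theorem jacobianMatrix_add_smul {d : ℕ} {Φ ψ : (Fin d → ℝ) → (Fin d → ℝ)}
    (hΦ : Differentiable ℝ Φ) (hψ : Differentiable ℝ ψ) (r : ℝ) (x : Fin d → ℝ) :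
    jacobianMatrix (fun z => Φ z + r • ψ z) x = jacobianMatrix Φ x + r • jacobianMatrix ψ x := by
  ext i j
  have h : HasFDerivAt (fun z => Φ z + r • ψ z) (fderiv ℝ Φ x + r • fderiv ℝ ψ x) x :=
    (hΦ x).hasFDerivAt.add ((hψ x).hasFDerivAt.const_smul r)
  simp [jacobianMatrix, h.fderiv]

theorem contDiff_jacobianMatrix_apply {d : ℕ} {Φ : (Fin d → ℝ) → (Fin d → ℝ)}
    (hΦ : ContDiff ℝ 2 Φ) (i j : Fin d) : ContDiff ℝ 1 fun x => jacobianMatrix Φ x i j :=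
  contDiff_pi.1 ((hΦ.fderiv_right (m := 1) (by norm_num)).clm_apply contDiff_const) i

theorem fderiv_apply_eq_sum_grad {d : ℕ} (f : (Fin d → ℝ) → ℝ) (x v : Fin d → ℝ) :
    fderiv ℝ f x v = ∑ i, grad f x i * v i := by
  conv_lhs => rw [pi_eq_sum_univ' v]
  simp [grad, mul_comm]

/-- **Differentiation under the integral sign for the transported integral**
(first identity in the proof of Lemma 3.2):
`d/ds |₀ ∫_Ω y · (λ ∘ (Φ + sψ)) · det D(Φ + sψ)
  = ∫_Ω [ y ⟨∇λ ∘ Φ, ψ⟩ det DΦ + y (λ ∘ Φ) det DΦ · trace ((DΦ)⁻¹ Dψ) ]`. -/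
theorem transported_integral_diff_under_integral (d : ℕ)
    (Ω : Set (Fin d → ℝ)) (hΩopen : IsOpen Ω) (hΩbdd : Bornology.IsBounded Ω)
    (Φ : (Fin d → ℝ) → (Fin d → ℝ)) (hΦ : ContDiff ℝ (⊤ : ℕ∞) Φ)
    (y lam : (Fin d → ℝ) → ℝ) (hy : ContDiff ℝ (⊤ : ℕ∞) y) (hlam : ContDiff ℝ (⊤ : ℕ∞) lam)
    (ψ : (Fin d → ℝ) → (Fin d → ℝ)) (hψ : ContDiff ℝ (⊤ : ℕ∞) ψ)
    (hinv : ∀ x ∈ closure Ω, IsUnit (jacobianMatrix Φ x)) :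
    HasDerivAt
      (fun s : ℝ => ∫ x in Ω,
        y x * lam (Φ x + s • ψ x) *
          (jacobianMatrix (fun z => Φ z + s • ψ z) x).det)
      (∫ x in Ω,
        (y x * (∑ i, grad lam (Φ x) i * ψ x i) * (jacobianMatrix Φ x).det
          + y x * lam (Φ x) * (jacobianMatrix Φ x).det *
            ((jacobianMatrix Φ x)⁻¹ * jacobianMatrix ψ x).trace))
      0 := by
  have h2 : (2 : WithTop ℕ∞) ≤ ((⊤ : ℕ∞) : WithTop ℕ∞) := WithTop.coe_le_coe.2 le_top
  have hΦ2 : ContDiff ℝ 2 Φ := hΦ.of_le h2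
  have hψ2 : ContDiff ℝ 2 ψ := hψ.of_le h2
  have hy1 : ContDiff ℝ 1 y := hy.of_le (by exact_mod_cast le_top)
  have hlam1 : ContDiff ℝ 1 lam := hlam.of_le (by exact_mod_cast le_top)
  have hΦ1 : ContDiff ℝ 1 Φ := hΦ2.of_le one_le_two
  have hψ1 : ContDiff ℝ 1 ψ := hψ2.of_le one_le_two
  simp only [jacobianMatrix_add_smul (hΦ2.differentiable two_ne_zero)
    (hψ2.differentiable two_ne_zero)]
  refine hasDerivAt_setIntegral_of_contDiff hΩopen.measurableSet hΩbdd ?_ 0 fun x hx => ?_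
  · have hJΦ := contDiff_jacobianMatrix_apply hΦ2
    have hJψ := contDiff_jacobianMatrix_apply hψ2
    simp only [Function.uncurry_def, Matrix.det_apply', Matrix.add_apply, Matrix.smul_apply,
      smul_eq_mul]
    refine ((hy1.comp contDiff_snd).mul (hlam1.comp ((hΦ1.comp contDiff_snd).add
      (contDiff_fst.smul (hψ1.comp contDiff_snd))))).mul ?_
    exact ContDiff.sum fun σ _ => contDiff_const.mul <| contDiff_prod fun i _ =>
      ((hJΦ _ _).comp contDiff_snd).add (contDiff_fst.mul ((hJψ _ _).comp contDiff_snd))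
  · have hline : HasDerivAt (fun r : ℝ => Φ x + r • ψ x) (ψ x) 0 := by
      simpa using ((hasDerivAt_id (0 : ℝ)).smul_const (ψ x)).const_add (Φ x)
    have hl : HasDerivAt (fun r : ℝ => lam (Φ x + r • ψ x))
        (∑ i, grad lam (Φ x) i * ψ x i) 0 := by
      rw [← fderiv_apply_eq_sum_grad]
      refine HasFDerivAt.comp_hasDerivAt (0 : ℝ) ?_ hline
      simpa using (hlam1.differentiable one_ne_zero (Φ x)).hasFDerivAt
    refine ((hl.const_mul (y x)).fun_mul (hasDerivAt_det_add_smul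
      (hinv x (subset_closure hx)) (jacobianMatrix ψ x))).congr_deriv ?_
    simp [mul_assoc]
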